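/- Let L be a finite-dimensional p-nilpotent restricted Lie algebra over a field F of characteristic p > 0, and let H be a restricted Lie algebra over F with u(L) ≅ u(H) as F-algebras. Then dim_F L/(L'^p + γ₃(L)) = dim_F H/(H'^p + γ₃(H)). -/

import Mathlib

open UniversalEnvelopingAlgebra

attribute [local instance 100] LieRing.ofAssociativeRing

/-- A restricted Lie algebra over a field `F` of characteristic `p`: a Lie algebra equipped
with a `p`-map `x ↦ x^[p]` satisfying Jacobson's identities.  The additive identity
`(x+y)^[p] = x^[p] + y^[p] + Σ sᵢ(x,y)` (with `sᵢ` the Jacobson polynomials) is expressed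
faithfully inside the universal enveloping algebra, where it reads
`ι((x+y)^[p]) - ι(x^[p]) - ι(y^[p]) = (ι x + ι y)^p - (ι x)^p - (ι y)^p`. -/
class RestrictedLieAlgebra (p : ℕ) (F : Type*) (L : Type*) [Field F]
    [LieRing L] [LieAlgebra F L] : Type _ where
  pOp : L → L
  pOp_smul : ∀ (a : F) (x : L), pOp (a • x) = a ^ p • pOp x
  ad_pOp : ∀ x y : L, ⁅pOp x, y⁆ = ((LieAlgebra.ad F L x) ^ p) y
  pOp_add : ∀ x y : L,
    ι F (pOp (x + y)) - ι F (pOp x) - ι F (pOp y)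
      = (ι F x + ι F y) ^ p - (ι F x) ^ p - (ι F y) ^ p

namespace RestrictedLieAlgebra

variable (p : ℕ) (F : Type*) [Field F]

section Defs

variable (L : Type*) [LieRing L] [LieAlgebra F L] [RestrictedLieAlgebra p F L]

/-- The `p`-map of a restricted Lie algebra. -/
abbrev pmap (x : L) : L := RestrictedLieAlgebra.pOp (p := p) (F := F) x

/-- The relation defining the restricted enveloping algebra as a quotient of the
universal enveloping algebra: `x^p = x^[p]` for all `x ∈ L`. -/
def uRel : UniversalEnvelopingAlgebra F L → UniversalEnvelopingAlgebra F L → Prop :=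
  fun a b => ∃ x : L, a = (ι F x) ^ p ∧ b = ι F (pmap p F L x)

/-- The restricted enveloping algebra `u(L)`: the quotient of the universal enveloping
algebra of `L` by the two-sided ideal generated by `{x^p - x^[p] : x ∈ L}`. -/
abbrev uEnv := RingQuot (uRel p F L)

/-- The canonical (linear) embedding `L → u(L)`. -/
def uemb : L →ₗ[F] uEnv p F L :=
  ((RingQuot.mkAlgHom F (uRel p F L)).toLinearMap).comp (ι F : L →ₗ⁅F⁆ _).toLinearMap

variable [Fact p.Prime]

/-- The augmentation map `ε : u(L) → F`, induced by `x ↦ 0` for `x ∈ L`. -/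
noncomputable def aug : uEnv p F L →ₐ[F] F :=
  RingQuot.liftAlgHom F
    ⟨(UniversalEnvelopingAlgebra.lift F) (0 : L →ₗ⁅F⁆ F), by
      rintro a b ⟨x, rfl, rfl⟩
      simp [UniversalEnvelopingAlgebra.lift_ι_apply,
        zero_pow (Nat.Prime.ne_zero (Fact.out : p.Prime))]⟩

/-- The augmentation ideal `ω(L)`, i.e. the kernel of the augmentation map, as a
subspace of `u(L)`. -/
noncomputable def omegaIdeal : Submodule F (uEnv p F L) :=
  LinearMap.ker (aug p F L).toLinearMap

/-- The image of `L` inside `u(L)`. -/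
def lSub : Submodule F (uEnv p F L) := LinearMap.range (uemb p F L)

end Defs

section Closure

variable {L : Type*} [LieRing L] [LieAlgebra F L] [RestrictedLieAlgebra p F L]

/-- The restricted subalgebra generated by a subset `S` of `L`: the smallest Lie
subalgebra containing `S` which is closed under the `p`-map. -/
def restrictedClosure (S : Set L) : LieSubalgebra F L :=
  sInf {K : LieSubalgebra F L | S ⊆ K ∧ ∀ x ∈ K, pmap p F L x ∈ K}

/-- For a subalgebra `N ⊆ L`, the restricted subalgebra `N^p` generated by all
`x^[p]`, `x ∈ N`. -/
def subPPow (K : LieSubalgebra F L) : LieSubalgebra F L :=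
  restrictedClosure p F (pmap p F L '' K)

end Closure

section PNilpotent

variable (L : Type*) [LieRing L] [LieAlgebra F L] [RestrictedLieAlgebra p F L]

/-- `L` is `p`-nilpotent if `L^{pˢ} = 0` for some `s`, where `L^p` denotes the restricted
subalgebra generated by all `x^[p]`. -/
def IsPNilpotent : Prop :=
  ∃ s : ℕ, (subPPow p F)^[s] (⊤ : LieSubalgebra F L) = ⊥

/-- The derived subalgebra `L' = γ₂(L)` as a submodule of `L`. -/
abbrev derivedSub : Submodule F L := (LieModule.lowerCentralSeries F L L 1).toSubmodule

/-- `L'_p`, the restricted subalgebra generated by `L'`, as a submodule. -/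
def derivedP : Submodule F L :=
  (restrictedClosure p F (derivedSub F L : Set L)).toSubmodule

/-- `L'^p + γ₃(L)`, as a submodule of `L`. -/
def mainIdeal : Submodule F L :=
  (subPPow p F (restrictedClosure p F (derivedSub F L : Set L))).toSubmodule
    ⊔ (LieModule.lowerCentralSeries F L L 2).toSubmodule

end PNilpotent

end RestrictedLieAlgebra
/-! ### Normal forms modulo `X_i ^ p - ℓ_i` -/

section NormalForm

open Finsupp

variable {ι F W : Type*} [Field F] [AddCommGroup W] [Module F W]

theorem degree_sub_single_add_single_lt {p : ℕ} (hp : 2 ≤ p) {a : ι →₀ ℕ} {i : ι}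
    (h : p ≤ a i) (j : ι) : (a - single i p + single j 1).degree < a.degree := by
  have ha : a - single i p + single i p = a :=
    tsub_add_cancel_of_le (by simpa using h)
  have h₁ := congrArg Finsupp.degree ha
  simp only [map_add, Finsupp.degree_single] at h₁ ⊢
  omega

open Classical in
/-- The values on monomials of the linear map with prescribed values `t` on truncated monomials
and satisfying `(X_i ^ p - ℓ_i) X^a ↦ φ i` if `a = 0` and `(X_i ^ p - ℓ_i) X^a ↦ 0` otherwise. -/
noncomputable def reduceMonomial (p : ℕ) (hp : 2 ≤ p) (l : ι → ι →₀ F) (t : (ι →₀ ℕ) → W)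
    (φ : ι → W) (a : ι →₀ ℕ) : W :=
  if h : ∃ i, p ≤ a i then
    (l h.choose).sum
      (fun j c => c • reduceMonomial p hp l t φ (a - single h.choose p + single j 1))
      + if a - single h.choose p = 0 then φ h.choose else 0
  else t a
termination_by a.degree
decreasing_by exact degree_sub_single_add_single_lt hp h.choose_spec j

theorem reduceMonomial_of_lt {p : ℕ} (hp : 2 ≤ p) (l : ι → ι →₀ F) (t : (ι →₀ ℕ) → W)
    (φ : ι → W) {a : ι →₀ ℕ} (ha : ∀ i, a i < p) : reduceMonomial p hp l t φ a = t a := by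
  rw [reduceMonomial, dif_neg]
  push Not
  exact ha

open Classical in
theorem reduceMonomial_add_single {p : ℕ} (hp : 2 ≤ p) (l : ι → ι →₀ F) (t : (ι →₀ ℕ) → W)
    (φ : ι → W) (b : ι →₀ ℕ) (i : ι) :
    reduceMonomial p hp l t φ (b + single i p) =
      (l i).sum (fun j c => c • reduceMonomial p hp l t φ (b + single j 1))
        + if b = 0 then φ i else 0 := by
  induction hn : b.degree using Nat.strong_induction_on generalizing b i with
  | _ n ih =>
    have h : ∃ k, p ≤ (b + single i p) k := ⟨i, by simp⟩
    rw [reduceMonomial, dif_pos h]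
    generalize hk : h.choose = k
    have hkp : p ≤ (b + single i p) k := hk ▸ h.choose_spec
    rcases eq_or_ne k i with rfl | hki
    · simp
    have hbk : p ≤ b k := by simpa [hki.symm] using hkp
    obtain ⟨d, rfl⟩ : ∃ d, b = d + single k p :=
      ⟨b - single k p, (tsub_add_cancel_of_le (by simpa using hbk)).symm⟩
    have hne (c : ι →₀ ℕ) (j : ι) {m : ℕ} (hm : m ≠ 0) : c + single j m ≠ 0 := by
      intro h0
      have := DFunLike.congr_fun h0 j
      simp at this
      omega
    have hdeg (j : ι) : (d + single j 1).degree < n := by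
      rw [← hn]
      simp only [map_add, Finsupp.degree_single]
      omega
    have hstep (x j : ι) : reduceMonomial p hp l t φ (d + single x p + single j 1) =
        (l x).sum (fun m c => c • reduceMonomial p hp l t φ (d + single j 1 + single m 1)) := by
      rw [add_right_comm, ih _ (hdeg j) _ _ rfl, if_neg (hne _ _ one_ne_zero), add_zero]
    have hsub : d + single k p + single i p - single k p = d + single i p := by
      rw [add_right_comm, add_tsub_cancel_right]
    rw [hsub, if_neg (hne _ _ (by omega)), if_neg (hne _ _ (by omega))]
    simp only [hstep i, hstep k, add_zero, Finsupp.smul_sum]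
    rw [Finsupp.sum_comm]
    refine Finsupp.sum_congr fun m _ => Finsupp.sum_congr fun j _ => ?_
    rw [smul_comm, add_right_comm]

open MvPolynomial

/-- The linear form with coefficient vector `v`. -/
noncomputable def linearForm (ι F : Type*) [Field F] : (ι →₀ F) →ₗ[F] MvPolynomial ι F :=
  Finsupp.linearCombination F X

/-- A linear map on polynomials with prescribed values on truncated monomials and prescribed
values on `(X_i ^ p - ℓ_i) b`, depending only on `i` and the constant coefficient of `b`. -/
theorem exists_linearMap_truncated {p : ℕ} (hp : 2 ≤ p) (l : ι → ι →₀ F) (t : (ι →₀ ℕ) → W)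
    (φ : ι → W) : ∃ Ψ : MvPolynomial ι F →ₗ[F] W,
      (∀ a : ι →₀ ℕ, (∀ i, a i < p) → Ψ (monomial a 1) = t a) ∧
      ∀ i b, Ψ ((X i ^ p - linearForm ι F (l i)) * b) = constantCoeff b • φ i := by
  classical
  set Ψ : MvPolynomial ι F →ₗ[F] W :=
    (basisMonomials ι F).constr F (reduceMonomial p hp l t φ) with hΨ
  have hmon (a : ι →₀ ℕ) : Ψ (monomial a 1) = reduceMonomial p hp l t φ a := by
    rw [hΨ, ← (basisMonomials ι F).constr_basis F (reduceMonomial p hp l t φ) a,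
      coe_basisMonomials]
  refine ⟨Ψ, fun a ha => by rw [hmon, reduceMonomial_of_lt hp l t φ ha], fun i b => ?_⟩
  induction b using MvPolynomial.induction_on' with
  | add b b' hb hb' => rw [mul_add, map_add, hb, hb', map_add, add_smul]
  | monomial a c =>
    have hX : (X i : MvPolynomial ι F) ^ p * monomial a 1 = monomial (a + single i p) 1 := by
      rw [X_pow_eq_monomial, monomial_mul, one_mul, add_comm]
    have hl : linearForm ι F (l i) * monomial a 1 =
        (l i).sum (fun j c => c • monomial (a + single j 1) (1 : F)) := by
      rw [linearForm, Finsupp.linearCombination_apply, Finsupp.sum_mul]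
      refine Finsupp.sum_congr fun j _ => ?_
      rw [smul_mul_assoc, X, monomial_mul, one_mul, add_comm]
    have hc : monomial a c = c • monomial a (1 : F) := by simp [smul_monomial]
    rw [hc, mul_smul_comm, map_smul, sub_mul, hX, hl, map_sub, hmon, map_finsuppSum,
      reduceMonomial_add_single]
    simp only [map_smul, hmon, add_sub_cancel_left, constantCoeff_smul, smul_eq_mul, mul_smul,
      constantCoeff_monomial]
    split_ifs <;> simp

/-- Exponents of truncated monomials. -/
abbrev TruncatedExponent (ι : Type*) (p : ℕ) : Type _ := {a : ι →₀ ℕ // ∀ i, a i < p}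

/-- The ideal generated by the polynomials `X_i ^ p - ℓ_i`. -/
noncomputable def powerIdeal (p : ℕ) (l : ι → ι →₀ F) : Ideal (MvPolynomial ι F) :=
  Ideal.span (Set.range fun i => X i ^ p - linearForm ι F (l i))

theorem monomial_mem_span_truncated_sup {p : ℕ} (hp : 2 ≤ p) (l : ι → ι →₀ F) (a : ι →₀ ℕ) :
    monomial a 1 ∈ Submodule.span F (Set.range fun b : TruncatedExponent ι p =>
      monomial b.1 (1 : F)) ⊔ (powerIdeal p l).restrictScalars F := by
  induction hn : a.degree using Nat.strong_induction_on generalizing a with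
  | _ n ih =>
    by_cases h : ∃ i, p ≤ a i
    · obtain ⟨i, hi⟩ := h
      have hlt := degree_sub_single_add_single_lt hp hi
      obtain ⟨d, rfl⟩ : ∃ d, a = d + single i p :=
        ⟨a - single i p, (tsub_add_cancel_of_le (by simpa using hi)).symm⟩
      rw [add_tsub_cancel_right, hn] at hlt
      have hsplit : monomial (d + single i p) (1 : F) =
          linearForm ι F (l i) * monomial d 1
            + monomial d 1 * (X i ^ p - linearForm ι F (l i)) := by
        rw [mul_comm, ← mul_add, add_sub_cancel, X_pow_eq_monomial, monomial_mul, one_mul]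
      rw [hsplit]
      refine add_mem ?_ (Submodule.mem_sup_right ?_)
      · rw [linearForm, Finsupp.linearCombination_apply, Finsupp.sum_mul]
        refine Submodule.sum_mem _ fun j _ => ?_
        beta_reduce
        rw [smul_mul_assoc, X, monomial_mul, one_mul, add_comm]
        exact Submodule.smul_mem _ _ (ih _ (hlt j) _ rfl)
      · exact Ideal.mul_mem_left _ _ (Ideal.subset_span ⟨i, rfl⟩)
    · push Not at h
      exact Submodule.mem_sup_left (Submodule.subset_span ⟨⟨a, h⟩, rfl⟩)

/-- The truncated monomials form a basis of the quotient by the polynomials `X_i ^ p - ℓ_i`. -/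
theorem nonempty_quotient_powerIdeal_equiv {p : ℕ} (hp : 2 ≤ p) (l : ι → ι →₀ F) :
    Nonempty ((MvPolynomial ι F ⧸ powerIdeal p l) ≃ₗ[F] (TruncatedExponent ι p →₀ F)) := by
  classical
  obtain ⟨Ψ, hΨt, hΨq⟩ := exists_linearMap_truncated (W := TruncatedExponent ι p →₀ F) hp l
    (fun a => if h : ∀ i, a i < p then single ⟨a, h⟩ 1 else 0) 0
  have hmon (b : TruncatedExponent ι p) : Ψ (monomial b.1 1) = single b 1 := by
    rw [hΨt _ b.2, dif_pos b.2]
  have hle : (powerIdeal p l).restrictScalars F ≤ LinearMap.ker Ψ := by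
    intro f hf
    suffices ∀ b, Ψ (f * b) = 0 by simpa using this 1
    rw [Submodule.restrictScalars_mem, powerIdeal] at hf
    induction hf using Submodule.span_induction with
    | mem x hx =>
      obtain ⟨i, rfl⟩ := hx
      intro b
      simpa using hΨq i b
    | zero => simp
    | add x y _ _ hx hy => simp [add_mul, hx, hy]
    | smul c x _ hx =>
      intro b
      rw [smul_eq_mul, mul_comm c, mul_assoc, hx]
  have hker : (powerIdeal p l).restrictScalars F = LinearMap.ker Ψ := by
    refine le_antisymm hle fun f hf => ?_
    have hf' : f ∈ Submodule.span F (Set.range fun b : TruncatedExponent ι p =>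
        monomial b.1 (1 : F)) ⊔ (powerIdeal p l).restrictScalars F := by
      have htop := (basisMonomials ι F).mem_span f
      refine Submodule.span_le.2 ?_ htop
      rintro _ ⟨a, rfl⟩
      simpa using monomial_mem_span_truncated_sup hp l a
    obtain ⟨u, hu, v, hv, rfl⟩ := Submodule.mem_sup.1 hf'
    obtain ⟨c, rfl⟩ := Finsupp.mem_span_range_iff_exists_finsupp.1 hu
    have hc : c = 0 := by
      have h₁ : Ψ (c.sum fun b r => r • monomial b.1 (1 : F)) = c := by
        rw [map_finsuppSum]
        simp only [map_smul, hmon, smul_single, smul_eq_mul, mul_one]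
        exact Finsupp.sum_single c
      have h₂ := LinearMap.mem_ker.1 hf
      rwa [map_add, LinearMap.mem_ker.1 (hle hv), add_zero, h₁] at h₂
    simpa [hc] using hv
  have hsurj : Function.Surjective Ψ := by
    intro c
    refine ⟨c.sum fun b r => r • monomial b.1 (1 : F), ?_⟩
    rw [map_finsuppSum]
    simp only [map_smul, hmon, smul_single, smul_eq_mul, mul_one]
    exact Finsupp.sum_single c
  exact ⟨(Submodule.Quotient.restrictScalarsEquiv F (powerIdeal p l)).symm ≪≫ₗ
    Submodule.quotEquivOfEq _ _ hker ≪≫ₗ Ψ.quotKerEquivOfSurjective hsurj⟩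

/-- The number of truncated monomials determines the number of variables. -/
theorem natCard_truncatedExponent [Finite ι] (p : ℕ) :
    Nat.card (TruncatedExponent ι p) = p ^ Nat.card ι := by
  have := Fintype.ofFinite ι
  let e : TruncatedExponent ι p ≃ (ι → Fin p) :=
    { toFun := fun a i => ⟨a.1 i, a.2 i⟩
      invFun := fun f => ⟨Finsupp.equivFunOnFinite.symm fun i => f i, fun i => by simp⟩
      left_inv := fun a => by ext; simp
      right_inv := fun f => by ext; simp }
  rw [Nat.card_congr e, Nat.card_fun]
  simp

theorem finite_of_finite_truncatedExponent {p : ℕ} (hp : 2 ≤ p)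
    [Finite (TruncatedExponent ι p)] : Finite ι := by
  classical
  refine Finite.of_injective (β := TruncatedExponent ι p)
    (fun i => ⟨single i 1, fun j => ?_⟩) fun i j hij => ?_
  · rw [single_apply]
    split_ifs <;> omega
  · exact Finsupp.single_left_injective one_ne_zero (congrArg Subtype.val hij)

theorem finite_truncatedExponent [Finite ι] {p : ℕ} (hp : 2 ≤ p) :
    Finite (TruncatedExponent ι p) := by
  refine Nat.finite_of_card_ne_zero ?_
  rw [natCard_truncatedExponent]
  exact pow_ne_zero _ (by omega)

end NormalForm

namespace RestrictedLieAlgebra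

/-! ### Generalities on restricted Lie algebras and restricted enveloping algebras -/

section Basic

variable (p : ℕ) (F : Type*) [Field F]
variable {L : Type*} [LieRing L] [LieAlgebra F L] [RestrictedLieAlgebra p F L]

theorem mem_restrictedClosure {S : Set L} {x : L} : x ∈ restrictedClosure p F S ↔
    ∀ K : LieSubalgebra F L, (S ⊆ K ∧ ∀ x ∈ K, pmap p F L x ∈ K) → x ∈ K := by
  rw [restrictedClosure, ← SetLike.mem_coe, LieSubalgebra.coe_sInf, Set.mem_iInter₂]
  rfl

theorem subset_restrictedClosure (S : Set L) : S ⊆ restrictedClosure p F S := by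
  intro x hx
  rw [SetLike.mem_coe, mem_restrictedClosure]
  exact fun K hK => hK.1 hx

theorem pmap_mem_restrictedClosure (S : Set L) {x : L} (hx : x ∈ restrictedClosure p F S) :
    pmap p F L x ∈ restrictedClosure p F S := by
  rw [mem_restrictedClosure] at hx ⊢
  exact fun K hK => hK.2 x (hx K hK)

theorem restrictedClosure_toSubmodule_le {S : Set L} {P : Submodule F L} (hS : S ⊆ P)
    (hlie : ∀ x ∈ P, ∀ y ∈ P, ⁅x, y⁆ ∈ P) (hp : ∀ x ∈ P, pmap p F L x ∈ P) :
    (restrictedClosure p F S).toSubmodule ≤ P := by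
  intro x hx
  rw [LieSubalgebra.mem_toSubmodule, mem_restrictedClosure] at hx
  exact hx { P with lie_mem' := fun {x y} hx hy => hlie x hx y hy } ⟨hS, hp⟩

theorem pmap_mem_subPPow {K : LieSubalgebra F L} {x : L} (hx : x ∈ K) :
    pmap p F L x ∈ subPPow p F K :=
  subset_restrictedClosure p F _ ⟨x, hx, rfl⟩

theorem pmap_iterate_mem (x : L) (s : ℕ) :
    (pmap p F L)^[s] x ∈ (subPPow p F)^[s] (⊤ : LieSubalgebra F L) := by
  induction s with
  | zero => simp
  | succ s ih =>
    rw [Function.iterate_succ_apply', Function.iterate_succ_apply']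
    exact pmap_mem_subPPow p F ih

theorem uemb_pmap (x : L) : uemb p F L (pmap p F L x) = uemb p F L x ^ p := by
  simp only [uemb, LinearMap.comp_apply, AlgHom.toLinearMap_apply, ← map_pow]
  exact (RingQuot.mkAlgHom_rel F ⟨x, rfl, rfl⟩).symm

theorem uemb_lie (x y : L) : uemb p F L ⁅x, y⁆ =
    uemb p F L x * uemb p F L y - uemb p F L y * uemb p F L x := by
  simp [uemb, LieRing.of_associative_ring_bracket]

theorem aug_uemb [Fact p.Prime] (x : L) : aug p F L (uemb p F L x) = 0 := by
  simp [aug, uemb]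

variable {p F} in
theorem algHom_ext {A : Type*} [Ring A] [Algebra F A] {f g : uEnv p F L →ₐ[F] A}
    (h : ∀ x, f (uemb p F L x) = g (uemb p F L x)) : f = g := by
  refine RingQuot.ringQuot_ext' F _ _ (UniversalEnvelopingAlgebra.hom_ext F ?_)
  ext x
  exact h x

variable {p F} in
/-- The universal property of the restricted enveloping algebra. -/
theorem exists_algHom {A : Type*} [Ring A] [Algebra F A] (f : L →ₗ⁅F⁆ A)
    (hf : ∀ x, f (pmap p F L x) = f x ^ p) :
    ∃ g : uEnv p F L →ₐ[F] A, ∀ x, g (uemb p F L x) = f x := by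
  refine ⟨RingQuot.liftAlgHom F ⟨UniversalEnvelopingAlgebra.lift F f, ?_⟩, fun x => ?_⟩
  · rintro _ _ ⟨x, rfl, rfl⟩
    simp [hf]
  · simp [uemb]

theorem adjoin_range_uemb : Algebra.adjoin F (Set.range (uemb p F L)) = ⊤ := by
  set S := Algebra.adjoin F (Set.range (uemb p F L)) with hS
  have hmem (x : L) : uemb p F L x ∈ S := Algebra.subset_adjoin ⟨x, rfl⟩
  let f : L →ₗ⁅F⁆ S :=
    { toFun := fun x => ⟨uemb p F L x, hmem x⟩
      map_add' := fun x y => by ext; simp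
      map_smul' := fun c x => by ext; simp
      map_lie' := fun {x y} => by
        ext
        simp [uemb_lie, LieRing.of_associative_ring_bracket] }
  obtain ⟨g, hg⟩ := exists_algHom (p := p) f fun x => by
    ext
    exact uemb_pmap p F x
  have hid : S.val.comp g = AlgHom.id F _ := algHom_ext fun x => by simp [hg, f]
  refine eq_top_iff.2 fun a _ => ?_
  have ha : (g a : uEnv p F L) = a := DFunLike.congr_fun hid a
  exact ha ▸ (g a).2

variable {p F} in
/-- The deviation of a Lie algebra homomorphism into an associative algebra from being
compatible with `p`-th powers. -/
def pDefect {A : Type*} [Ring A] [Algebra F A] (f : L →ₗ⁅F⁆ A) (x : L) : A :=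
  f x ^ p - f (pmap p F L x)

theorem pDefect_add {A : Type*} [Ring A] [Algebra F A] (f : L →ₗ⁅F⁆ A) (x y : L) :
    pDefect (p := p) f (x + y) = pDefect (p := p) f x + pDefect (p := p) f y := by
  have h := congrArg (UniversalEnvelopingAlgebra.lift F f)
    (RestrictedLieAlgebra.pOp_add (p := p) (F := F) x y)
  simp only [map_sub, map_add, map_pow, UniversalEnvelopingAlgebra.lift_ι_apply] at h
  simp only [pDefect, pmap, map_add]
  rw [sub_sub, sub_sub, sub_eq_sub_iff_add_eq_add] at h
  rw [← sub_eq_zero] at h ⊢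
  rw [← neg_eq_zero, ← h]
  abel

theorem pDefect_smul {A : Type*} [Ring A] [Algebra F A] (f : L →ₗ⁅F⁆ A) (c : F) (x : L) :
    pDefect (p := p) f (c • x) = c ^ p • pDefect (p := p) f x := by
  simp [pDefect, pmap, RestrictedLieAlgebra.pOp_smul, smul_pow, smul_sub]

/-- The elements whose `p`-defect acts into a given subspace form a subspace. -/
def defectSubmodule [Fact p.Prime] {A : Type*} [Ring A] [Algebra F A] (f : L →ₗ⁅F⁆ A)
    (N : Submodule F A) : Submodule F L where
  carrier := {x | pDefect (p := p) f x ∈ N}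
  add_mem' {x y} hx hy := by
    change pDefect f (x + y) ∈ N
    rw [pDefect_add]
    exact add_mem hx hy
  zero_mem' := by
    have h := pDefect_smul p F f 0 (0 : L)
    rw [zero_pow (Nat.Prime.ne_zero Fact.out), zero_smul, zero_smul] at h
    change pDefect f 0 ∈ N
    rw [h]
    exact zero_mem _
  smul_mem' c x hx := by
    change pDefect f (c • x) ∈ N
    rw [pDefect_smul]
    exact N.smul_mem _ hx

theorem lie_mem_lowerCentralSeries_succ {k : ℕ} (x : L) {y : L}
    (hy : y ∈ LieModule.lowerCentralSeries F L L k) :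
    ⁅x, y⁆ ∈ LieModule.lowerCentralSeries F L L (k + 1) := by
  rw [LieModule.lowerCentralSeries_succ]
  exact LieSubmodule.lie_mem_lie (LieSubmodule.mem_top x) hy

theorem lowerCentralSeries_succ_toSubmodule_le {k : ℕ} {P : Submodule F L}
    (h : ∀ x : L, ∀ y ∈ LieModule.lowerCentralSeries F L L k, ⁅x, y⁆ ∈ P) :
    (LieModule.lowerCentralSeries F L L (k + 1)).toSubmodule ≤ P := by
  rw [LieModule.lowerCentralSeries_succ, LieSubmodule.lieIdeal_oper_eq_linear_span',
    Submodule.span_le]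
  rintro _ ⟨x, -, y, hy, rfl⟩
  exact h x y hy

theorem lie_mem_derivedP (x y : L) : ⁅x, y⁆ ∈ derivedP p F L :=
  subset_restrictedClosure p F _ (lie_mem_lowerCentralSeries_succ F (k := 0) x (by simp))

theorem derivedSub_le_derivedP : derivedSub F L ≤ derivedP p F L :=
  subset_restrictedClosure p F _

theorem derivedP_le {P : Submodule F L} (hlie : ∀ x y : L, ⁅x, y⁆ ∈ P)
    (hp : ∀ x ∈ P, pmap p F L x ∈ P) : derivedP p F L ≤ P :=
  restrictedClosure_toSubmodule_le p F
    (lowerCentralSeries_succ_toSubmodule_le F fun x y _ => hlie x y) (fun x _ y _ => hlie x y) hp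

theorem pmap_mem_derivedP {x : L} (hx : x ∈ derivedP p F L) :
    pmap p F L x ∈ derivedP p F L :=
  pmap_mem_restrictedClosure p F _ hx

theorem mainIdeal_le_derivedP : mainIdeal p F L ≤ derivedP p F L := by
  refine sup_le (restrictedClosure_toSubmodule_le p F ?_
    (fun x _ y _ => lie_mem_derivedP p F x y) fun x hx => pmap_mem_derivedP p F hx) ?_
  · rintro _ ⟨x, hx, rfl⟩
    exact pmap_mem_derivedP p F hx
  · exact le_trans (LieModule.antitone_lowerCentralSeries F L L one_le_two)
      (derivedSub_le_derivedP p F)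

theorem pmap_mem_mainIdeal {x : L} (hx : x ∈ derivedP p F L) :
    pmap p F L x ∈ mainIdeal p F L :=
  Submodule.mem_sup_left (pmap_mem_subPPow p F hx)

theorem lie_pmap_mem [Fact p.Prime] (x y : L) :
    ⁅pmap p F L x, y⁆ ∈ LieModule.lowerCentralSeries F L L 2 := by
  have key (n : ℕ) : (LieAlgebra.ad F L x ^ (n + 2)) y ∈
      LieModule.lowerCentralSeries F L L 2 := by
    induction n with
    | zero =>
      simp only [pow_two, zero_add, Module.End.mul_apply, LieAlgebra.ad_apply]
      exact lie_mem_lowerCentralSeries_succ F x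
        (lie_mem_lowerCentralSeries_succ F (k := 0) x (by simp))
    | succ n ih =>
      rw [add_right_comm, pow_succ', Module.End.mul_apply, LieAlgebra.ad_apply]
      exact LieSubmodule.lie_mem _ ih
  obtain ⟨n, hn⟩ := Nat.exists_eq_add_of_le' (Nat.Prime.two_le (Fact.out : p.Prime))
  rw [pmap, RestrictedLieAlgebra.ad_pOp]
  simpa only [hn] using key n

theorem lie_mem_of_mem_derivedP [Fact p.Prime] {x : L} (hx : x ∈ derivedP p F L) (y : L) :
    ⁅x, y⁆ ∈ LieModule.lowerCentralSeries F L L 2 := by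
  let P : Submodule F L :=
    { carrier := {x | ∀ y : L, ⁅x, y⁆ ∈ LieModule.lowerCentralSeries F L L 2}
      add_mem' := fun {a b} ha hb y => by rw [add_lie]; exact add_mem (ha y) (hb y)
      zero_mem' := fun y => by simp
      smul_mem' := fun c a ha y => by
        rw [smul_lie]; exact (LieModule.lowerCentralSeries F L L 2).smul_mem c (ha y) }
  have hP : derivedP p F L ≤ P := by
    refine restrictedClosure_toSubmodule_le p F (fun a ha y => ?_) (fun a ha b hb y => ?_)
      fun a ha y => lie_pmap_mem p F a y
    · rw [← lie_skew, neg_mem_iff]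
      exact lie_mem_lowerCentralSeries_succ F y ha
    · rw [← lie_skew, neg_mem_iff]
      exact LieSubmodule.lie_mem _ (ha b)
  exact hP hx y

end Basic

end RestrictedLieAlgebra

/-! ### The largest commutative quotient of an algebra -/

section Abelianization

variable (F : Type*) [Field F] {A B : Type*} [Ring A] [Algebra F A] [Ring B] [Algebra F B]

/-- The relation identifying `a * b` with `b * a`. -/
def CommutatorRel (A : Type*) [Ring A] : A → A → Prop :=
  fun x y => ∃ a b, x = a * b ∧ y = b * a

/-- The largest commutative quotient of a ring. -/
abbrev AlgAbelianization (A : Type*) [Ring A] : Type _ := RingQuot (CommutatorRel A)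

namespace AlgAbelianization

theorem mul_comm' (x y : AlgAbelianization A) : x * y = y * x := by
  obtain ⟨a, rfl⟩ := RingQuot.mkRingHom_surjective _ x
  obtain ⟨b, rfl⟩ := RingQuot.mkRingHom_surjective _ y
  rw [← map_mul, ← map_mul]
  exact RingQuot.mkRingHom_rel ⟨a, b, rfl, rfl⟩

noncomputable local instance : CommRing (AlgAbelianization A) :=
  { (inferInstance : Ring (AlgAbelianization A)) with mul_comm := mul_comm' }

/-- The map of commutative quotients induced by an algebra homomorphism. -/
noncomputable def map (f : A →ₐ[F] B) : AlgAbelianization A →ₐ[F] AlgAbelianization B :=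
  RingQuot.liftAlgHom F ⟨(RingQuot.mkAlgHom F (CommutatorRel B)).comp f, by
    rintro _ _ ⟨a, b, rfl, rfl⟩
    simp only [map_mul]
    exact mul_comm' _ _⟩

/-- The isomorphism of commutative quotients induced by an algebra isomorphism. -/
noncomputable def congr (e : A ≃ₐ[F] B) : AlgAbelianization A ≃ₐ[F] AlgAbelianization B :=
  AlgEquiv.ofAlgHom (map F e.toAlgHom) (map F e.symm.toAlgHom)
    (by
      refine RingQuot.ringQuot_ext' F _ _ ?_
      ext x
      simp [map])
    (by
      refine RingQuot.ringQuot_ext' F _ _ ?_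
      ext x
      simp [map])

/-- A homomorphism from a polynomial ring to the largest commutative quotient. -/
noncomputable def aeval {ι : Type*} (g : ι → AlgAbelianization A) :
    MvPolynomial ι F →ₐ[F] AlgAbelianization A :=
  MvPolynomial.aeval g

@[simp]
theorem aeval_X {ι : Type*} (g : ι → AlgAbelianization A) (i : ι) :
    aeval F g (MvPolynomial.X i) = g i :=
  MvPolynomial.aeval_X g i

end AlgAbelianization

end Abelianization

namespace RestrictedLieAlgebra

section Abelian

open MvPolynomial

variable {p : ℕ} {F : Type*} [Field F]
variable {L : Type*} [LieRing L] [LieAlgebra F L] [RestrictedLieAlgebra p F L]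
variable {ι : Type*} (b : Module.Basis ι F (L ⧸ derivedP p F L))

/-- A lift of a basis of `L / L'_p` to `L`. -/
noncomputable def basisLift (i : ι) : L :=
  Function.surjInv (Submodule.mkQ_surjective (derivedP p F L)) (b i)

@[simp]
theorem mkQ_basisLift (i : ι) : (derivedP p F L).mkQ (basisLift b i) = b i :=
  Function.surjInv_eq _ _

theorem eq_top_of_basisLift_mem {P : Submodule F L} (hP : derivedP p F L ≤ P)
    (hb : ∀ i, basisLift b i ∈ P) : P = ⊤ := by
  have hmap : P.map (derivedP p F L).mkQ = ⊤ := by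
    rw [eq_top_iff, ← b.span_eq, Submodule.span_le]
    rintro _ ⟨i, rfl⟩
    exact ⟨_, hb i, mkQ_basisLift b i⟩
  have h := congrArg (Submodule.comap (derivedP p F L).mkQ) hmap
  rwa [Submodule.comap_map_mkQ, Submodule.comap_top, sup_eq_right.2 hP] at h

/-- The class modulo `L'_p` of an element of `L`, as a linear form. -/
noncomputable def polyLinear : L →ₗ[F] MvPolynomial ι F :=
  linearForm ι F ∘ₗ b.repr.toLinearMap ∘ₗ (derivedP p F L).mkQ

theorem polyLinear_eq_zero {x : L} (hx : x ∈ derivedP p F L) : polyLinear b x = 0 := by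
  have : (derivedP p F L).mkQ x = 0 := by simpa using hx
  simp only [polyLinear, LinearMap.comp_apply, this, map_zero]

@[simp]
theorem polyLinear_basisLift (i : ι) : polyLinear b (basisLift b i) = X i := by
  simp only [polyLinear, LinearMap.comp_apply, mkQ_basisLift]
  simp [linearForm]

/-- The coordinates modulo `L'_p` of the `p`-th powers of the lifted basis. -/
noncomputable def pmapCoord (i : ι) : ι →₀ F :=
  b.repr ((derivedP p F L).mkQ (pmap p F L (basisLift b i)))

theorem polyLinear_pmap_basisLift (i : ι) :
    polyLinear b (pmap p F L (basisLift b i)) = linearForm ι F (pmapCoord b i) := rfl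

/-- `polyLinear` as a homomorphism of Lie algebras. -/
noncomputable def polyLie : L →ₗ⁅F⁆ MvPolynomial ι F :=
  { polyLinear b with
    map_lie' := fun {x y} => by
      change polyLinear b ⁅x, y⁆ = _
      rw [polyLinear_eq_zero b (lie_mem_derivedP p F x y)]
      simp [LieRing.of_associative_ring_bracket, mul_comm] }

variable [Fact p.Prime]

theorem polyLinear_pow_sub_mem (x : L) :
    polyLinear b x ^ p - polyLinear b (pmap p F L x) ∈ powerIdeal p (pmapCoord b) := by
  have hp : p ≠ 0 := Nat.Prime.ne_zero Fact.out
  have h : defectSubmodule p F (polyLie b) ((powerIdeal p (pmapCoord b)).restrictScalars F)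
      = ⊤ := by
    refine eq_top_of_basisLift_mem b (fun x hx => ?_) fun i => ?_
    · change polyLinear b x ^ p - polyLinear b (pmap p F L x) ∈ powerIdeal p (pmapCoord b)
      rw [polyLinear_eq_zero b hx, polyLinear_eq_zero b (pmap_mem_derivedP p F hx), zero_pow hp,
        sub_zero]
      exact zero_mem _
    · change polyLinear b _ ^ p - polyLinear b (pmap p F L _) ∈ powerIdeal p (pmapCoord b)
      rw [polyLinear_pmap_basisLift, polyLinear_basisLift]
      exact Ideal.subset_span ⟨i, rfl⟩
  exact h.ge (Submodule.mem_top (x := x))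

/-- The largest commutative quotient of `u(L)`, by generators and relations. -/
theorem nonempty_abelianization_equiv : Nonempty (AlgAbelianization (uEnv p F L) ≃ₐ[F]
    (MvPolynomial ι F ⧸ powerIdeal p (pmapCoord b))) := by
  let q := Ideal.Quotient.mkₐ F (powerIdeal p (pmapCoord b))
  obtain ⟨g, hg⟩ := exists_algHom (p := p) (q.toLieHom.comp (polyLie b)) fun x => by
    have h := polyLinear_pow_sub_mem b x
    rw [← Ideal.Quotient.eq, map_pow] at h
    exact h.symm
  replace hg (x : L) : g (uemb p F L x) = q (polyLinear b x) := hg x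
  let f₁ : AlgAbelianization (uEnv p F L) →ₐ[F] _ := RingQuot.liftAlgHom F ⟨g, by
    rintro _ _ ⟨a, b, rfl, rfl⟩
    rw [map_mul, map_mul, mul_comm]⟩
  let m := RingQuot.mkAlgHom F (CommutatorRel (uEnv p F L))
  let h := AlgAbelianization.aeval F fun i => m (uemb p F L (basisLift b i))
  have hh (x : L) : h (polyLinear b x) = m (uemb p F L x) := by
    have htop : LinearMap.eqLocus (h.toLinearMap ∘ₗ polyLinear b)
        (m.toLinearMap ∘ₗ uemb p F L) = ⊤ := by
      refine eq_top_of_basisLift_mem b (fun x hx => ?_) fun i => ?_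
      · rw [LinearMap.mem_eqLocus, LinearMap.comp_apply, polyLinear_eq_zero b hx, map_zero]
        refine (derivedP_le p F (P := LinearMap.ker (m.toLinearMap ∘ₗ uemb p F L))
          (fun y z => ?_) (fun y hy => ?_) hx).symm
        · rw [LinearMap.mem_ker, LinearMap.comp_apply, uemb_lie, map_sub, sub_eq_zero]
          simp only [AlgHom.toLinearMap_apply, map_mul]
          exact AlgAbelianization.mul_comm' _ _
        · simp only [LinearMap.mem_ker, LinearMap.comp_apply, AlgHom.toLinearMap_apply] at hy ⊢
          rw [uemb_pmap, map_pow, hy, zero_pow (Nat.Prime.ne_zero Fact.out)]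
      · simp [h]
    exact htop.ge (Submodule.mem_top (x := x))
  have hker : ∀ a ∈ powerIdeal p (pmapCoord b), h a = 0 := by
    intro a ha
    suffices powerIdeal p (pmapCoord b) ≤ RingHom.ker h from this ha
    rw [powerIdeal, Ideal.span_le]
    rintro _ ⟨i, rfl⟩
    rw [SetLike.mem_coe, RingHom.mem_ker, map_sub, map_pow, ← polyLinear_pmap_basisLift, hh,
      ← polyLinear_basisLift b i, hh, uemb_pmap, map_pow, sub_self]
  let f₂ := Ideal.Quotient.liftₐ _ h hker
  refine ⟨AlgEquiv.ofAlgHom f₁ f₂ ?_ ?_⟩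
  · refine Ideal.Quotient.algHom_ext _ (MvPolynomial.algHom_ext fun i => ?_)
    change f₁ (h (X i)) = q (X i)
    rw [← polyLinear_basisLift b i, hh, ← hg]
    exact RingQuot.liftAlgHom_mkAlgHom_apply F g _ _
  · refine RingQuot.ringQuot_ext' F _ _ (algHom_ext fun x => ?_)
    simp only [f₁, f₂, AlgHom.comp_apply, RingQuot.liftAlgHom_mkAlgHom_apply, hg]
    exact hh x

theorem finrank_quotient_derivedP_eq {H : Type*} [LieRing H] [LieAlgebra F H]
    [RestrictedLieAlgebra p F H] [Module.Finite F L] (e : uEnv p F L ≃ₐ[F] uEnv p F H) :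
    Module.Finite F (H ⧸ derivedP p F H) ∧
      Module.finrank F (L ⧸ derivedP p F L) = Module.finrank F (H ⧸ derivedP p F H) := by
  have hp : 2 ≤ p := Nat.Prime.two_le Fact.out
  let b := Module.Basis.ofVectorSpace F (L ⧸ derivedP p F L)
  let b' := Module.Basis.ofVectorSpace F (H ⧸ derivedP p F H)
  obtain ⟨e₁⟩ := nonempty_abelianization_equiv b
  obtain ⟨e₂⟩ := nonempty_abelianization_equiv b'
  obtain ⟨e₃⟩ := nonempty_quotient_powerIdeal_equiv hp (pmapCoord b)
  obtain ⟨e₄⟩ := nonempty_quotient_powerIdeal_equiv hp (pmapCoord b')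
  let E := e₃.symm ≪≫ₗ
    (e₁.symm.trans ((AlgAbelianization.congr F e).trans e₂)).toLinearEquiv ≪≫ₗ e₄
  have := Module.Finite.finite_basis b
  have := finite_truncatedExponent
    (ι := Module.Basis.ofVectorSpaceIndex F (L ⧸ derivedP p F L)) hp
  have := Module.Finite.equiv E
  have := Module.Finite.finite_basis (Finsupp.basisSingleOne (R := F)
    (ι := TruncatedExponent (Module.Basis.ofVectorSpaceIndex F (H ⧸ derivedP p F H)) p))
  have := finite_of_finite_truncatedExponent
    (ι := Module.Basis.ofVectorSpaceIndex F (H ⧸ derivedP p F H)) hp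
  refine ⟨Module.Finite.of_basis b', ?_⟩
  have hE := E.finrank_eq
  rw [Module.finrank_eq_nat_card_basis Finsupp.basisSingleOne,
    Module.finrank_eq_nat_card_basis Finsupp.basisSingleOne, natCard_truncatedExponent,
    natCard_truncatedExponent] at hE
  rw [Module.finrank_eq_nat_card_basis b, Module.finrank_eq_nat_card_basis b']
  exact Nat.pow_right_injective hp hE

end Abelian

end RestrictedLieAlgebra

/-! ### The commutator ideal and its product with the augmentation ideal -/

section CommutatorIdeal

variable (F A : Type*) [Field F] [Ring A] [Algebra F A] {B : Type*} [Ring B] [Algebra F B]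

/-- The span of the commutators of an algebra. -/
def commutatorSpan : Submodule F A :=
  Submodule.span F {x | ∃ a b : A, x = a * b - b * a}

/-- The two-sided ideal generated by the commutators, as a subspace. -/
def commutatorIdeal : Submodule F A := ⊤ * commutatorSpan F A * ⊤

variable {A}

/-- The subspace `Jω + ωJ`, where `J` is the commutator ideal. -/
def mixedProduct (ω : Submodule F A) : Submodule F A :=
  commutatorIdeal F A * ω ⊔ ω * commutatorIdeal F A

variable {F} in
theorem map_commutatorSpan (e : A ≃ₐ[F] B) :
    (commutatorSpan F A).map e.toAlgHom.toLinearMap = commutatorSpan F B := by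
  rw [commutatorSpan, commutatorSpan, Submodule.map_span]
  congr 1
  ext x
  constructor
  · rintro ⟨_, ⟨a, b, rfl⟩, rfl⟩
    exact ⟨e a, e b, by simp⟩
  · rintro ⟨a, b, rfl⟩
    exact ⟨e.symm a * e.symm b - e.symm b * e.symm a, ⟨_, _, rfl⟩, by simp⟩

variable {F} in
theorem map_commutatorIdeal (e : A ≃ₐ[F] B) :
    (commutatorIdeal F A).map e.toAlgHom.toLinearMap = commutatorIdeal F B := by
  have htop : (⊤ : Submodule F A).map e.toAlgHom.toLinearMap = ⊤ := by
    rw [Submodule.map_top, LinearMap.range_eq_top]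
    exact e.surjective
  rw [commutatorIdeal, Submodule.map_mul, Submodule.map_mul, map_commutatorSpan, htop,
    commutatorIdeal]

variable {F} in
theorem map_mixedProduct (e : A ≃ₐ[F] B) (ω : Submodule F A) :
    (mixedProduct F ω).map e.toAlgHom.toLinearMap =
      mixedProduct F (ω.map e.toAlgHom.toLinearMap) := by
  rw [mixedProduct, Submodule.map_sup, Submodule.map_mul, Submodule.map_mul, map_commutatorIdeal,
    mixedProduct]

variable {F} in
/-- The quotient `J / (Jω + ωJ)` is preserved by isomorphisms. -/
theorem nonempty_commutatorIdeal_quotient_equiv (e : A ≃ₐ[F] B) {ω : Submodule F A}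
    {ω' : Submodule F B} (h : ω.map e.toAlgHom.toLinearMap = ω') :
    Nonempty ((commutatorIdeal F A).map (mixedProduct F ω).mkQ ≃ₗ[F]
      (commutatorIdeal F B).map (mixedProduct F ω').mkQ) := by
  let E := Submodule.Quotient.equiv (mixedProduct F ω) (mixedProduct F ω') e.toLinearEquiv
    (by rw [← h, ← map_mixedProduct]; rfl)
  have hE : ((commutatorIdeal F A).map (mixedProduct F ω).mkQ).map E.toLinearMap =
      (commutatorIdeal F B).map (mixedProduct F ω').mkQ := by
    rw [← map_commutatorIdeal e, ← Submodule.map_comp, ← Submodule.map_comp]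
    rfl
  exact ⟨E.submoduleMap _ ≪≫ₗ LinearEquiv.ofEq _ _ hE⟩

theorem commutatorSpan_le_commutatorIdeal : commutatorSpan F A ≤ commutatorIdeal F A := by
  intro x hx
  rw [← one_mul x, ← mul_one (1 * x)]
  exact Submodule.mul_mem_mul (Submodule.mul_mem_mul trivial hx) trivial

theorem commutator_mem_commutatorIdeal (a b : A) : a * b - b * a ∈ commutatorIdeal F A :=
  commutatorSpan_le_commutatorIdeal F (Submodule.subset_span ⟨a, b, rfl⟩)

theorem commutatorIdeal_mul_mem {x : A} (hx : x ∈ commutatorIdeal F A) (a : A) :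
    x * a ∈ commutatorIdeal F A := by
  have h : commutatorIdeal F A * ⊤ ≤ commutatorIdeal F A := by
    rw [commutatorIdeal, mul_assoc]
    exact mul_le_mul' le_rfl le_top
  exact h (Submodule.mul_mem_mul hx trivial)

theorem mul_commutatorIdeal_mem {x : A} (hx : x ∈ commutatorIdeal F A) (a : A) :
    a * x ∈ commutatorIdeal F A := by
  have h : ⊤ * commutatorIdeal F A ≤ commutatorIdeal F A := by
    rw [commutatorIdeal, ← mul_assoc, ← mul_assoc]
    exact mul_le_mul' (mul_le_mul' le_top le_rfl) le_rfl
  exact h (Submodule.mul_mem_mul trivial hx)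

/-- The commutator ideal lies in every subspace containing the commutators and closed under
multiplication by arbitrary elements. -/
theorem commutatorIdeal_le {P : Submodule F A} (hc : ∀ a b : A, a * b - b * a ∈ P)
    (hl : ∀ a, ∀ x ∈ P, a * x ∈ P) (hr : ∀ a, ∀ x ∈ P, x * a ∈ P) : commutatorIdeal F A ≤ P := by
  refine Submodule.mul_le.2 fun x hx b _ => hr b x ?_
  refine (Submodule.mul_le.2 fun a _ c hc' => hl a c ?_) hx
  refine Submodule.span_le.2 ?_ hc'
  rintro _ ⟨a, b, rfl⟩
  exact hc a b

theorem mixedProduct_le_commutatorIdeal (ω : Submodule F A) :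
    mixedProduct F ω ≤ commutatorIdeal F A :=
  sup_le (Submodule.mul_le.2 fun _ hx a _ => commutatorIdeal_mul_mem F hx a)
    (Submodule.mul_le.2 fun a _ _ hx => mul_commutatorIdeal_mem F hx a)

theorem commutator_central_add {A : Type*} [Ring A] {c d : A} (hc : ∀ a, c * a = a * c) (hd : ∀ a, d * a = a * d)
    (x y : A) : (c + x) * (d + y) - (d + y) * (c + x) = x * y - y * x := by
  rw [mul_add, add_mul, add_mul, hc d, hc y, mul_add, add_mul, add_mul, hd x]
  abel

end CommutatorIdeal

namespace RestrictedLieAlgebra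

section Augmentation

variable (p : ℕ) (F : Type*) [Field F] [Fact p.Prime]
variable {L : Type*} [LieRing L] [LieAlgebra F L] [RestrictedLieAlgebra p F L]

theorem mem_omegaIdeal {a : uEnv p F L} : a ∈ omegaIdeal p F L ↔ aug p F L a = 0 := Iff.rfl

theorem uemb_mem_omegaIdeal (x : L) : uemb p F L x ∈ omegaIdeal p F L := aug_uemb p F x

theorem mul_mem_omegaIdeal_left {x : uEnv p F L} (hx : x ∈ omegaIdeal p F L) (a : uEnv p F L) :
    x * a ∈ omegaIdeal p F L := by
  rw [mem_omegaIdeal] at hx ⊢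
  rw [map_mul, hx, zero_mul]

theorem mul_mem_omegaIdeal_right {x : uEnv p F L} (hx : x ∈ omegaIdeal p F L) (a : uEnv p F L) :
    a * x ∈ omegaIdeal p F L := by
  rw [mem_omegaIdeal] at hx ⊢
  rw [map_mul, hx, mul_zero]

theorem omegaIdeal_mul_omegaIdeal_le :
    omegaIdeal p F L * omegaIdeal p F L ≤ omegaIdeal p F L :=
  Submodule.mul_le.2 fun _ hx a _ => mul_mem_omegaIdeal_left p F hx a

theorem commutatorIdeal_le_omegaIdeal : commutatorIdeal F (uEnv p F L) ≤ omegaIdeal p F L :=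
  commutatorIdeal_le F (fun a b => by simp [mem_omegaIdeal, mul_comm])
    (fun a _ hx => mul_mem_omegaIdeal_right p F hx a)
    (fun a _ hx => mul_mem_omegaIdeal_left p F hx a)

theorem exists_eq_add_uemb_add (a : uEnv p F L) : ∃ (c : F) (x : L),
    ∃ w ∈ omegaIdeal p F L * omegaIdeal p F L, a = algebraMap F _ c + uemb p F L x + w := by
  have ha : a ∈ Algebra.adjoin F (Set.range (uemb p F L)) := by
    rw [adjoin_range_uemb]
    trivial
  induction ha using Algebra.adjoin_induction with
  | mem a ha =>
    obtain ⟨x, rfl⟩ := ha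
    exact ⟨0, x, 0, zero_mem _, by simp⟩
  | algebraMap c => exact ⟨c, 0, 0, zero_mem _, by simp⟩
  | add a a' _ _ h h' =>
    obtain ⟨c, x, w, hw, rfl⟩ := h
    obtain ⟨c', x', w', hw', rfl⟩ := h'
    exact ⟨c + c', x + x', w + w', add_mem hw hw', by simp only [map_add]; abel⟩
  | mul a a' _ _ h h' =>
    obtain ⟨c, x, w, hw, rfl⟩ := h
    obtain ⟨c', x', w', hw', rfl⟩ := h'
    have hle := omegaIdeal_mul_omegaIdeal_le p F (L := L)
    have hx := uemb_mem_omegaIdeal p F x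
    have hx' := uemb_mem_omegaIdeal p F x'
    refine ⟨c * c', c • x' + c' • x, c • w' + c' • w + (uemb p F L x + w) * (uemb p F L x' + w'),
      add_mem (add_mem (Submodule.smul_mem _ _ hw') (Submodule.smul_mem _ _ hw))
        (Submodule.mul_mem_mul (add_mem hx (hle hw)) (add_mem hx' (hle hw'))), ?_⟩
    simp only [map_mul, map_add, map_smul, Algebra.smul_def, mul_add, add_mul,
      ← Algebra.commutes c']
    abel

theorem commutator_mem_mixedProduct {w v : uEnv p F L}
    (hw : w ∈ omegaIdeal p F L * omegaIdeal p F L) :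
    w * v - v * w ∈ mixedProduct F (omegaIdeal p F L) := by
  induction hw using Submodule.mul_induction_on' with
  | mem_mul_mem m hm n hn =>
    have : m * n * v - v * (m * n) = m * (n * v - v * n) + (m * v - v * m) * n := by noncomm_ring
    rw [this]
    exact add_mem
      (Submodule.mem_sup_right (Submodule.mul_mem_mul hm (commutator_mem_commutatorIdeal F n v)))
      (Submodule.mem_sup_left (Submodule.mul_mem_mul (commutator_mem_commutatorIdeal F m v) hn))
  | add w _ w' _ h h' =>
    have : (w + w') * v - v * (w + w') = (w * v - v * w) + (w' * v - v * w') := by noncomm_ring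
    rw [this]
    exact add_mem h h'

theorem commutator_mem_derivedSub_sup (a b : uEnv p F L) : a * b - b * a ∈
    (derivedSub F L).map (uemb p F L) ⊔ mixedProduct F (omegaIdeal p F L) := by
  obtain ⟨c, x, w, hw, rfl⟩ := exists_eq_add_uemb_add p F a
  obtain ⟨d, y, v, hv, rfl⟩ := exists_eq_add_uemb_add p F b
  have hsplit : (algebraMap F _ c + uemb p F L x + w) * (algebraMap F _ d + uemb p F L y + v)
      - (algebraMap F _ d + uemb p F L y + v) * (algebraMap F _ c + uemb p F L x + w)
      = uemb p F L ⁅x, y⁆ + (w * (uemb p F L y + v) - (uemb p F L y + v) * w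
        - (v * uemb p F L x - uemb p F L x * v)) := by
    rw [uemb_lie, add_assoc, add_assoc,
      commutator_central_add (Algebra.commutes c) (Algebra.commutes d)]
    noncomm_ring
  rw [hsplit]
  exact add_mem
    (Submodule.mem_sup_left ⟨_, lie_mem_lowerCentralSeries_succ F (k := 0) x (by simp), rfl⟩)
    (Submodule.mem_sup_right (sub_mem (commutator_mem_mixedProduct p F hw)
      (commutator_mem_mixedProduct p F hv)))

theorem uemb_mem_commutatorIdeal {x : L} (hx : x ∈ derivedP p F L) :
    uemb p F L x ∈ commutatorIdeal F (uEnv p F L) := by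
  refine derivedP_le p F (P := (commutatorIdeal F (uEnv p F L)).comap (uemb p F L))
    (fun y z => ?_) (fun y hy => ?_) hx
  · rw [Submodule.mem_comap, uemb_lie]
    exact commutator_mem_commutatorIdeal F _ _
  · rw [Submodule.mem_comap, uemb_pmap, ← mul_pow_sub_one (Nat.Prime.ne_zero Fact.out)]
    exact commutatorIdeal_mul_mem F hy _

theorem mul_mem_mixedProduct {x y : uEnv p F L} (hx : x ∈ commutatorIdeal F (uEnv p F L))
    (hy : y ∈ omegaIdeal p F L) : x * y ∈ mixedProduct F (omegaIdeal p F L) :=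
  Submodule.mem_sup_left (Submodule.mul_mem_mul hx hy)

theorem commutatorIdeal_le_derivedSub_sup : commutatorIdeal F (uEnv p F L) ≤
    (derivedSub F L).map (uemb p F L) ⊔ mixedProduct F (omegaIdeal p F L) := by
  set U := (derivedSub F L).map (uemb p F L) ⊔ mixedProduct F (omegaIdeal p F L) with hU
  have hUJ : U ≤ commutatorIdeal F (uEnv p F L) := by
    refine sup_le ?_ (mixedProduct_le_commutatorIdeal F _)
    rintro _ ⟨x, hx, rfl⟩
    exact uemb_mem_commutatorIdeal p F (derivedSub_le_derivedP p F hx)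
  have hdecomp (a : uEnv p F L) : a - algebraMap F _ (aug p F L a) ∈ omegaIdeal p F L := by
    simp [mem_omegaIdeal]
  refine commutatorIdeal_le F (commutator_mem_derivedSub_sup p F) (fun a x hx => ?_)
    fun a x hx => ?_
  · have hsplit : a * x = aug p F L a • x + (a - algebraMap F _ (aug p F L a)) * x := by
      rw [Algebra.smul_def, sub_mul, add_sub_cancel]
    rw [hsplit]
    exact add_mem (U.smul_mem _ hx) (Submodule.mem_sup_right
      (Submodule.mem_sup_right (Submodule.mul_mem_mul (hdecomp a) (hUJ hx))))
  · have hsplit : x * a = aug p F L a • x + x * (a - algebraMap F _ (aug p F L a)) := by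
      rw [Algebra.smul_def, mul_sub, Algebra.commutes, add_sub_cancel]
    rw [hsplit]
    exact add_mem (U.smul_mem _ hx) (Submodule.mem_sup_right
      (mul_mem_mixedProduct p F (hUJ hx) (hdecomp a)))

theorem pow_mem_mixedProduct {x : uEnv p F L} (hx : x ∈ commutatorIdeal F (uEnv p F L)) :
    x ^ p ∈ mixedProduct F (omegaIdeal p F L) := by
  have hpow : x ^ p = x * (x * x ^ (p - 2)) := by
    rw [← pow_succ', ← pow_succ']
    congr 1
    have := Nat.Prime.two_le (Fact.out : p.Prime)
    omega
  rw [hpow]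
  exact mul_mem_mixedProduct p F hx
    (mul_mem_omegaIdeal_left p F (commutatorIdeal_le_omegaIdeal p F hx) _)

theorem uemb_mem_mixedProduct {x : L} (hx : x ∈ mainIdeal p F L) :
    uemb p F L x ∈ mixedProduct F (omegaIdeal p F L) := by
  have hKJ := mixedProduct_le_commutatorIdeal F (omegaIdeal p F L)
  suffices mainIdeal p F L ≤ (mixedProduct F (omegaIdeal p F L)).comap (uemb p F L) from this hx
  refine sup_le (restrictedClosure_toSubmodule_le p F ?_ (fun y hy z hz => ?_) fun y hy => ?_) ?_
  · rintro _ ⟨y, hy, rfl⟩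
    rw [SetLike.mem_coe, Submodule.mem_comap, uemb_pmap]
    exact pow_mem_mixedProduct p F (uemb_mem_commutatorIdeal p F hy)
  · rw [Submodule.mem_comap, uemb_lie]
    exact sub_mem (mul_mem_mixedProduct p F (hKJ hy) (uemb_mem_omegaIdeal p F z))
      (mul_mem_mixedProduct p F (hKJ hz) (uemb_mem_omegaIdeal p F y))
  · rw [Submodule.mem_comap, uemb_pmap]
    exact pow_mem_mixedProduct p F (hKJ hy)
  · refine lowerCentralSeries_succ_toSubmodule_le F fun y z hz => ?_
    have hz' := uemb_mem_commutatorIdeal p F (derivedSub_le_derivedP p F hz)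
    have hy := uemb_mem_omegaIdeal p F y
    rw [Submodule.mem_comap, uemb_lie]
    exact sub_mem (Submodule.mem_sup_right (Submodule.mul_mem_mul hy hz'))
      (mul_mem_mixedProduct p F hz' hy)

end Augmentation

end RestrictedLieAlgebra

/-! ### A representation detecting functionals that vanish on `L'^p + γ₃(L)` -/

section LinearAlgebra

/-- An alternating form is the antisymmetrization of a bilinear form with at least the same
radical on both sides. -/
theorem exists_sub_flip_eq {F M : Type*} [Field F] [AddCommGroup M] [Module F M]
    (β : M →ₗ[F] M →ₗ[F] F) (hβ : ∀ x, β x x = 0) :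
    ∃ c : M →ₗ[F] M →ₗ[F] F, (∀ x y, c x y - c y x = β x y) ∧
      ∀ w, β w = 0 → ∀ y, c w y = 0 ∧ c y w = 0 := by
  classical
  have hskew (x y : M) : β y x = -β x y := by
    have h := hβ (x + y)
    simp only [map_add, LinearMap.add_apply, hβ, zero_add, add_zero] at h
    exact eq_neg_of_add_eq_zero_left h
  let b := Module.Basis.ofVectorSpace F M
  let : LinearOrder (Module.Basis.ofVectorSpaceIndex F M) := linearOrderOfSTO WellOrderingRel
  let c₀ : M →ₗ[F] M →ₗ[F] F := b.constr F fun i => b.constr F fun j =>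
    if i < j then β (b i) (b j) else 0
  have hc₀ : c₀ - c₀.flip = β := by
    refine b.ext fun i => b.ext fun j => ?_
    simp only [c₀, LinearMap.sub_apply, LinearMap.flip_apply, Module.Basis.constr_basis]
    rcases lt_trichotomy i j with h | rfl | h
    · simp [h, h.not_gt]
    · simp [hβ]
    · simp [h, h.not_gt, hskew (b i) (b j)]
  obtain ⟨s, hs⟩ := (LinearMap.ker β).mkQ.exists_rightInverse_of_surjective
    (Submodule.range_mkQ _)
  let P := s ∘ₗ (LinearMap.ker β).mkQ
  have hP (x : M) : β (P x) = β x := by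
    have h : (LinearMap.ker β).mkQ (P x) = (LinearMap.ker β).mkQ x := DFunLike.congr_fun hs _
    rw [Submodule.mkQ_apply, Submodule.mkQ_apply, Submodule.Quotient.eq, LinearMap.mem_ker,
      map_sub, sub_eq_zero] at h
    exact h
  refine ⟨c₀.compl₁₂ P P, fun x y => ?_, fun w hw y => ?_⟩
  · have h := LinearMap.congr_fun₂ hc₀ (P x) (P y)
    simp only [LinearMap.sub_apply, LinearMap.flip_apply] at h
    rw [LinearMap.compl₁₂_apply, LinearMap.compl₁₂_apply, h, hP, ← neg_neg (β x (P y)),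
      ← hskew, hP, ← hskew]
  · have hPw : P w = 0 := by
      have h : (LinearMap.ker β).mkQ w = 0 := by simpa using hw
      simp only [P, LinearMap.comp_apply, h, map_zero]
    simp [hPw]

open MvPolynomial in
theorem exists_linearPart {F M ι : Type*} [Field F] [AddCommGroup M] [Module F M] (e : ι → M) :
    ∃ lin : MvPolynomial ι F →ₗ[F] M, ∀ v b, lin (linearForm ι F v * b) =
      constantCoeff b • Finsupp.linearCombination F e v := by
  classical
  let f : (ι →₀ ℕ) → M := fun a =>
    if h : ∃ i, a = Finsupp.single i 1 then e h.choose else 0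
  let lin : MvPolynomial ι F →ₗ[F] M := (basisMonomials ι F).constr F f
  have hmon (a : ι →₀ ℕ) : lin (monomial a 1) =
      if h : ∃ i, a = Finsupp.single i 1 then e h.choose else 0 := by
    have h := (basisMonomials ι F).constr_basis F f a
    rwa [coe_basisMonomials] at h
  have hX (i : ι) (b : MvPolynomial ι F) : lin (X i * b) = constantCoeff b • e i := by
    induction b using MvPolynomial.induction_on' with
    | add b b' hb hb' => rw [mul_add, map_add, hb, hb', map_add, add_smul]
    | monomial a c =>
      have hc : X i * monomial a c = c • monomial (Finsupp.single i 1 + a) (1 : F) := by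
        rw [X, monomial_mul, one_mul, smul_monomial, smul_eq_mul, mul_one]
      rw [hc, map_smul, hmon, constantCoeff_monomial]
      rcases eq_or_ne a 0 with rfl | ha
      · have h : ∃ j, Finsupp.single i 1 + 0 = Finsupp.single j 1 := ⟨i, add_zero _⟩
        rw [dif_pos h, if_pos rfl]
        have hi : i = h.choose :=
          Finsupp.single_left_injective one_ne_zero ((add_zero _).symm.trans h.choose_spec)
        rw [← hi]
      · rw [dif_neg, if_neg ha, smul_zero, zero_smul]
        rintro ⟨j, hj⟩
        have hdeg := congrArg Finsupp.degree hj
        rw [map_add, Finsupp.degree_single, Finsupp.degree_single, Nat.add_eq_left,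
          Finsupp.degree_eq_zero_iff] at hdeg
        exact ha hdeg
  refine ⟨lin, fun v b => ?_⟩
  rw [linearForm, Finsupp.linearCombination_apply, Finsupp.sum_mul, map_finsuppSum,
    Finsupp.linearCombination_apply, Finsupp.smul_sum]
  refine Finsupp.sum_congr fun j _ => ?_
  rw [smul_mul_assoc, map_smul, hX, smul_comm]

theorem commutatorIdeal_le_of_adjoin {F A : Type*} [Field F] [Ring A] [Algebra F A] {S : Set A}
    (hS : Algebra.adjoin F S = ⊤) {P : Submodule F A}
    (hc : ∀ a ∈ S, ∀ b ∈ S, a * b - b * a ∈ P)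
    (hl : ∀ a, ∀ x ∈ P, a * x ∈ P) (hr : ∀ a, ∀ x ∈ P, x * a ∈ P) : commutatorIdeal F A ≤ P := by
  have key (b : A) (hb : ∀ a ∈ S, a * b - b * a ∈ P) (a : A) : a * b - b * a ∈ P := by
    have ha : a ∈ Algebra.adjoin F S := hS ▸ Algebra.mem_top
    induction ha using Algebra.adjoin_induction with
    | mem a ha => exact hb a ha
    | algebraMap c => rw [Algebra.commutes, sub_self]; exact zero_mem _
    | add a a' _ _ h h' =>
      have : (a + a') * b - b * (a + a') = (a * b - b * a) + (a' * b - b * a') := by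
        noncomm_ring
      rw [this]
      exact add_mem h h'
    | mul a a' _ _ h h' =>
      have : a * a' * b - b * (a * a') = a * (a' * b - b * a') + (a * b - b * a) * a' := by
        noncomm_ring
      rw [this]
      exact add_mem (hl _ _ h') (hr _ _ h)
  refine commutatorIdeal_le F (fun a b => key b (fun s hs => ?_) a) hl hr
  rw [← neg_sub, neg_mem_iff]
  exact key s (fun t ht => hc t ht s hs) b

end LinearAlgebra

namespace RestrictedLieAlgebra

section Representation

variable {p : ℕ} {F : Type*} [Field F] [Fact p.Prime]
variable {L : Type*} [LieRing L] [LieAlgebra F L] [RestrictedLieAlgebra p F L]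

/-- A criterion for `Jω + ωJ` to act by zero on a module. -/
theorem mixedProduct_le_ker {Q : Type*} [AddCommGroup Q] [Module F Q]
    (g : uEnv p F L →ₐ[F] Module.End F Q) (z : Q) (ε : Q →ₗ[F] F)
    (hz : ∀ x, g (uemb p F L x) z = 0) (hε : ∀ x v, ε (g (uemb p F L x) v) = 0)
    (hlie : ∀ x y : L, ∃ k : F, ∀ v, g (uemb p F L ⁅x, y⁆) v = (k * ε v) • z) :
    mixedProduct F (omegaIdeal p F L) ≤ LinearMap.ker g.toLinearMap := by
  have hgz (a : uEnv p F L) : g a z = aug p F L a • z := by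
    have ha : a ∈ Algebra.adjoin F (Set.range (uemb p F L)) := by
      rw [adjoin_range_uemb]
      trivial
    induction ha using Algebra.adjoin_induction with
    | mem a ha =>
      obtain ⟨x, rfl⟩ := ha
      rw [hz, aug_uemb, zero_smul]
    | algebraMap c => simp
    | add a a' _ _ h h' => simp [h, h', add_smul]
    | mul a a' _ _ h h' => simp [h, h', smul_smul, mul_comm]
  have hgε (a : uEnv p F L) (v : Q) : ε (g a v) = aug p F L a * ε v := by
    have ha : a ∈ Algebra.adjoin F (Set.range (uemb p F L)) := by
      rw [adjoin_range_uemb]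
      trivial
    induction ha using Algebra.adjoin_induction generalizing v with
    | mem a ha =>
      obtain ⟨x, rfl⟩ := ha
      rw [hε, aug_uemb, zero_mul]
    | algebraMap c => simp
    | add a a' _ _ h h' => simp [h, h', add_mul]
    | mul a a' _ _ h h' => simp [h, h', mul_assoc]
  let P : Submodule F (uEnv p F L) :=
    { carrier := {a | ∃ k : F, ∀ v, g a v = (k * ε v) • z}
      add_mem' := by
        rintro a a' ⟨k, hk⟩ ⟨k', hk'⟩
        exact ⟨k + k', fun v => by rw [map_add, LinearMap.add_apply, hk, hk', add_mul, add_smul]⟩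
      zero_mem' := ⟨0, fun v => by simp⟩
      smul_mem' := by
        rintro c a ⟨k, hk⟩
        exact ⟨c * k, fun v => by
          rw [map_smul, LinearMap.smul_apply, hk, smul_smul, mul_assoc]⟩ }
  have hJ : commutatorIdeal F (uEnv p F L) ≤ P := by
    refine commutatorIdeal_le_of_adjoin (adjoin_range_uemb p F) ?_ ?_ ?_
    · rintro _ ⟨x, rfl⟩ _ ⟨y, rfl⟩
      rw [← uemb_lie]
      exact hlie x y
    · rintro a x ⟨k, hk⟩
      refine ⟨aug p F L a * k, fun v => ?_⟩
      rw [map_mul, Module.End.mul_apply, hk, map_smul, hgz, smul_smul]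
      ring_nf
    · rintro a x ⟨k, hk⟩
      refine ⟨k * aug p F L a, fun v => ?_⟩
      rw [map_mul, Module.End.mul_apply, hk, hgε, mul_assoc]
  refine sup_le (Submodule.mul_le.2 fun a ha w hw => ?_) (Submodule.mul_le.2 fun w hw a ha => ?_)
  · obtain ⟨k, hk⟩ := hJ ha
    rw [mem_omegaIdeal] at hw
    ext v
    simp [hk, hgε, hw]
  · obtain ⟨k, hk⟩ := hJ ha
    rw [mem_omegaIdeal] at hw
    ext v
    simp [hk, hgz, hw]

end Representation

end RestrictedLieAlgebra

namespace RestrictedLieAlgebra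

section Detection

open MvPolynomial

variable {p : ℕ} {F : Type*} [Field F]
variable {L : Type*} [LieRing L] [LieAlgebra F L] [RestrictedLieAlgebra p F L]
variable {ι : Type*} (b : Module.Basis ι F (L ⧸ derivedP p F L))

theorem constantCoeff_polyLinear (x : L) : constantCoeff (polyLinear b x) = 0 := by
  simp [polyLinear, linearForm, Finsupp.linearCombination_apply, map_finsuppSum,
    constantCoeff_smul]

theorem linearCombination_basisLift_sub_mem (x : L) :
    Finsupp.linearCombination F (basisLift b) (b.repr ((derivedP p F L).mkQ x)) - x ∈
      derivedP p F L := by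
  rw [← Submodule.Quotient.mk_eq_zero, ← Submodule.mkQ_apply, map_sub, sub_eq_zero,
    Finsupp.apply_linearCombination]
  have h : (derivedP p F L).mkQ ∘ basisLift b = b := funext (mkQ_basisLift b)
  rw [h, b.linearCombination_repr]

variable [Fact p.Prime]

/-- The extension of the action of `L` on the symmetric algebra of `L / L'_p` by a trivial
one-dimensional module that is attached to a functional on `L / (L'^p + γ₃(L))`. -/
theorem exists_extension (lam : L →ₗ[F] F) (hlam : mainIdeal p F L ≤ LinearMap.ker lam) :
    ∃ (T : L →ₗ⁅F⁆ Module.End F (MvPolynomial ι F × F)) (ρ : L → F),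
      (∀ x v, (T x v).1 = polyLinear b x * v.1) ∧ (∀ x, T x (0, 1) = 0) ∧
      (∀ x ∈ derivedP p F L, ρ x = 0) ∧
      (∀ x ∈ derivedP p F L, ∀ v, T x v = (0, lam x * constantCoeff v.1)) ∧
      (∀ x v, pDefect (p := p) T x v =
        ((polyLinear b x ^ p - polyLinear b (pmap p F L x)) * v.1, constantCoeff v.1 * ρ x)) ∧
      ∀ x y v, T y (pDefect (p := p) T x v) =
        pDefect (p := p) T x (polyLinear b y * v.1, 0) := by
  obtain ⟨n, hn⟩ : ∃ n, p = n + 2 :=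
    Nat.exists_eq_add_of_le' (Nat.Prime.two_le (Fact.out : p.Prime))
  have hlcs {x : L} (hx : x ∈ LieModule.lowerCentralSeries F L L 2) : lam x = 0 :=
    hlam (Submodule.mem_sup_right hx)
  let β : L →ₗ[F] L →ₗ[F] F := LinearMap.compr₂ (LieModule.toEnd F L L : L →ₗ[F] _) lam
  have hβ (x y : L) : β x y = lam ⁅x, y⁆ := rfl
  obtain ⟨c, hc, hrad⟩ := exists_sub_flip_eq β fun x => by rw [hβ, lie_self, map_zero]
  have hrad₁ {w : L} (hw : w ∈ derivedP p F L) (y : L) : c w y = 0 ∧ c y w = 0 :=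
    hrad w (LinearMap.ext fun z => hlcs (lie_mem_of_mem_derivedP p F hw z)) y
  have hrad₂ (w y : L) : c (pmap p F L w) y = 0 ∧ c y (pmap p F L w) = 0 :=
    hrad _ (LinearMap.ext fun z => hlcs (lie_pmap_mem p F w z)) y
  obtain ⟨lin, hlin⟩ := exists_linearPart (F := F) (basisLift b)
  have hclin (x y : L) (q : MvPolynomial ι F) :
      c x (lin (polyLinear b y * q)) = constantCoeff q * c x y := by
    have h : c x (Finsupp.linearCombination F (basisLift b)
        (b.repr ((derivedP p F L).mkQ y))) = c x y := by
      rw [← sub_eq_zero, ← map_sub]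
      exact (hrad₁ (linearCombination_basisLift_sub_mem b y) x).2
    rw [← h, ← smul_eq_mul (constantCoeff q), ← map_smul, ← hlin]
    rfl
  have hε (x : L) (q : MvPolynomial ι F) : constantCoeff (polyLinear b x * q) = 0 := by
    rw [map_mul, constantCoeff_polyLinear, zero_mul]
  let act : L →ₗ[F] Module.End F (MvPolynomial ι F × F) :=
    { toFun := fun x =>
        { toFun := fun v =>
            (polyLinear b x * v.1, c x (lin v.1) + lam x * constantCoeff v.1)
          map_add' := fun v w => by
            ext1 <;> simp <;> ring
          map_smul' := fun k v => by
            ext1 <;> simp [constantCoeff_smul] ; ring }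
      map_add' := fun x y => by
        refine LinearMap.ext fun v => ?_
        ext1 <;> simp <;> ring
      map_smul' := fun k x => by
        refine LinearMap.ext fun v => ?_
        ext1 <;> simp ; ring }
  have hact (x : L) (v : MvPolynomial ι F × F) : act x v =
      (polyLinear b x * v.1, c x (lin v.1) + lam x * constantCoeff v.1) := rfl
  have hact₂ (x y : L) (v : MvPolynomial ι F × F) : act x (act y v) =
      (polyLinear b x * (polyLinear b y * v.1), constantCoeff v.1 * c x y) := by
    rw [hact, hact, hclin, hε, mul_zero, add_zero]
  let T : L →ₗ⁅F⁆ Module.End F (MvPolynomial ι F × F) :=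
    { act with
      map_lie' := fun {x y} => by
        refine LinearMap.ext fun v => ?_
        change act ⁅x, y⁆ v = act x (act y v) - act y (act x v)
        rw [hact₂, hact₂, hact, polyLinear_eq_zero b (lie_mem_derivedP p F x y),
          (hrad₁ (lie_mem_derivedP p F x y) _).1, ← hβ, ← hc]
        ext1
        · simp only [Prod.fst_sub]; ring
        · simp only [Prod.snd_sub]; ring }
  have hT (x : L) (v : MvPolynomial ι F × F) : T x v =
      (polyLinear b x * v.1, c x (lin v.1) + lam x * constantCoeff v.1) := rfl
  have hpow (x : L) (m : ℕ) (v : MvPolynomial ι F × F) : (T x ^ (m + 2)) v =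
      (polyLinear b x ^ (m + 2) * v.1, constantCoeff v.1 * (0 ^ m * c x x)) := by
    induction m generalizing v with
    | zero =>
      rw [zero_add, pow_two, Module.End.mul_apply]
      refine (hact₂ x x v).trans ?_
      ext1
      · ring
      · simp
    | succ m ih =>
      rw [pow_succ, Module.End.mul_apply, ih, hT, hε, zero_mul]
      ext1
      · ring
      · simp
  let ρ : L → F := fun x => 0 ^ n * c x x - lam (pmap p F L x)
  have hdef (x : L) (v : MvPolynomial ι F × F) : pDefect (p := p) T x v =
      ((polyLinear b x ^ p - polyLinear b (pmap p F L x)) * v.1, constantCoeff v.1 * ρ x) := by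
    have h := hpow x n v
    rw [← hn] at h
    rw [pDefect, LinearMap.sub_apply, h, hT, (hrad₂ x _).1]
    ext1
    · simp only [Prod.fst_sub]; ring
    · simp only [Prod.snd_sub, ρ]; ring
  refine ⟨T, ρ, fun x v => rfl, fun x => ?_, fun x hx => ?_, fun x hx v => ?_, hdef,
    fun x y v => ?_⟩
  · rw [hT]
    simp
  · simp only [ρ]
    rw [(hrad₁ hx x).1, hlam (pmap_mem_mainIdeal p F hx), mul_zero, sub_zero]
  · rw [hT, polyLinear_eq_zero b hx, (hrad₁ hx _).1, zero_mul, zero_add]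
  · have h : (polyLinear b x ^ p - polyLinear b (pmap p F L x)) * v.1 =
        polyLinear b x * (polyLinear b x * (polyLinear b x ^ n * v.1)) -
          polyLinear b (pmap p F L x) * v.1 := by
      have hpn : polyLinear b x ^ p = polyLinear b x ^ (n + 2) := congrArg _ hn
      rw [hpn]
      ring
    rw [hdef, hdef, hT, hε, zero_mul]
    ext1
    · ring
    · simp only [h]
      rw [map_sub, map_sub, hclin, hclin, map_sub, hε, hε, (hrad₂ x y).2, hε]
      simp

theorem mem_mainIdeal_of_uemb_mem_mixedProduct {x : L} (hx : x ∈ derivedP p F L)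
    (hmem : uemb p F L x ∈ mixedProduct F (omegaIdeal p F L)) : x ∈ mainIdeal p F L := by
  by_contra hxM
  obtain ⟨lam, hlamx, hlam⟩ := Submodule.exists_le_ker_of_notMem hxM
  refine hlamx ?_
  obtain ⟨⟨ι, b⟩⟩ := Module.Free.exists_basis F (L ⧸ derivedP p F L)
  obtain ⟨T, ρ, hfst, hz, hρ, hTP, hdef, hTdef⟩ := exists_extension b lam hlam
  obtain ⟨Ψ, -, hΨ⟩ := exists_linearMap_truncated
    (Nat.Prime.two_le (Fact.out : p.Prime)) (pmapCoord b) (fun _ => (0 : F))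
    fun i => -ρ (basisLift b i)
  let N : Submodule F (MvPolynomial ι F × F) :=
    Submodule.span F {w | ∃ y v, w = pDefect (p := p) T y v}
  have hN (y : L) (v) : pDefect (p := p) T y v ∈ N := Submodule.subset_span ⟨y, v, rfl⟩
  have hTN (y : L) : N ≤ N.comap (T y) := by
    refine Submodule.span_le.2 ?_
    rintro _ ⟨x, v, rfl⟩
    change T y _ ∈ N
    rw [hTdef]
    exact hN _ _
  let ε : (MvPolynomial ι F × F) →ₗ[F] F :=
    (MvPolynomial.lcoeff F 0) ∘ₗ LinearMap.fst F _ F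
  have hε (v : MvPolynomial ι F × F) : ε v = constantCoeff v.1 := rfl
  have hεT (y : L) (v) : ε (T y v) = 0 := by
    rw [hε, hfst, map_mul, constantCoeff_polyLinear, zero_mul]
  have hεN : N ≤ LinearMap.ker ε := by
    refine Submodule.span_le.2 ?_
    rintro _ ⟨y, v, rfl⟩
    change ε _ = 0
    rw [hε, hdef, map_mul, map_sub, map_pow, constantCoeff_polyLinear, constantCoeff_polyLinear,
      zero_pow (Nat.Prime.ne_zero Fact.out), sub_zero, zero_mul]
  let Λ : (MvPolynomial ι F × F) →ₗ[F] F := LinearMap.snd F _ F + Ψ ∘ₗ LinearMap.fst F _ F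
  have hΛ (v : MvPolynomial ι F × F) : Λ v = v.2 + Ψ v.1 := rfl
  have hΛN : N ≤ LinearMap.ker Λ := by
    have htop : defectSubmodule p F T
        (LinearMap.ker (LinearMap.compRight F Λ :
          Module.End F (MvPolynomial ι F × F) →ₗ[F] _)) = ⊤ := by
      refine eq_top_of_basisLift_mem b (fun y hy => ?_) fun i => ?_
      · refine LinearMap.ext fun v => ?_
        change Λ (pDefect (p := p) T y v) = 0
        rw [hdef, hρ y hy, polyLinear_eq_zero b hy,
          polyLinear_eq_zero b (pmap_mem_derivedP p F hy), hΛ,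
          zero_pow (Nat.Prime.ne_zero Fact.out)]
        simp
      · refine LinearMap.ext fun v => ?_
        change Λ (pDefect (p := p) T _ v) = 0
        rw [hdef, hΛ, polyLinear_pmap_basisLift, polyLinear_basisLift, hΨ]
        simp
    refine Submodule.span_le.2 ?_
    rintro _ ⟨y, v, rfl⟩
    exact LinearMap.congr_fun (htop.ge (Submodule.mem_top (x := y))) v
  let f : L →ₗ⁅F⁆ Module.End F ((MvPolynomial ι F × F) ⧸ N) :=
    { toFun := fun y => N.mapQ N (T y) (hTN y)
      map_add' := fun y y' => by
        refine Submodule.linearMap_qext _ (LinearMap.ext fun v => ?_)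
        simp
      map_smul' := fun k y => by
        refine Submodule.linearMap_qext _ (LinearMap.ext fun v => ?_)
        simp
      map_lie' := fun {y y'} => by
        refine Submodule.linearMap_qext _ (LinearMap.ext fun v => ?_)
        simp [LieRing.of_associative_ring_bracket] }
  have hf (y : L) (v) : f y (N.mkQ v) = N.mkQ (T y v) := rfl
  obtain ⟨g, hg⟩ := exists_algHom (p := p) f fun y => by
    refine Submodule.linearMap_qext _ (LinearMap.ext fun v => ?_)
    change N.mkQ (T _ v) = ((N.mapQ N (T y) (hTN y)) ^ p) (N.mkQ v)
    rw [← Submodule.mapQ_pow]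
    change N.mkQ (T _ v) = N.mkQ ((T y ^ p) v)
    rw [eq_comm, ← sub_eq_zero, ← map_sub, Submodule.mkQ_apply, Submodule.Quotient.mk_eq_zero]
    exact hN y v
  have hker := mixedProduct_le_ker g (N.mkQ (0, 1)) (N.liftQ ε hεN)
    (fun y => by rw [hg, hf, hz, map_zero])
    (fun y v => by
      obtain ⟨v, rfl⟩ := N.mkQ_surjective v
      rw [hg, hf]
      exact hεT y v)
    (fun y y' => ⟨lam ⁅y, y'⁆, fun v => by
      obtain ⟨v, rfl⟩ := N.mkQ_surjective v
      rw [hg, hf, hTP _ (lie_mem_derivedP p F y y'), ← map_smul]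
      congr 1
      simp [hε]⟩)
  have h := LinearMap.congr_fun (hker hmem) (N.mkQ (1, 0))
  rw [AlgHom.toLinearMap_apply, hg, hf, hTP x hx, LinearMap.zero_apply, Submodule.mkQ_apply,
    Submodule.Quotient.mk_eq_zero] at h
  simpa [hΛ] using hΛN h

end Detection

end RestrictedLieAlgebra

/-! ### The dimension of `L / (L'^p + γ₃(L))` -/

namespace RestrictedLieAlgebra

section Dimension

variable (p : ℕ) (F : Type*) [Field F]
variable {L : Type*} [LieRing L] [LieAlgebra F L] [RestrictedLieAlgebra p F L]
variable {H : Type*} [LieRing H] [LieAlgebra F H] [RestrictedLieAlgebra p F H]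

variable (L) in
theorem finrank_quotient_mainIdeal [Module.Finite F (L ⧸ mainIdeal p F L)] :
    Module.finrank F (L ⧸ mainIdeal p F L) = Module.finrank F (L ⧸ derivedP p F L) +
      Module.finrank F ((derivedP p F L).map (mainIdeal p F L).mkQ) := by
  rw [← Submodule.finrank_quotient_add_finrank ((derivedP p F L).map (mainIdeal p F L).mkQ),
    (Submodule.quotientQuotientEquivQuotient _ _ (mainIdeal_le_derivedP p F)).finrank_eq]

variable [Fact p.Prime]

variable (L) in
/-- `L'_p / (L'^p + γ₃(L))` is isomorphic to `J / (Jω + ωJ)`, where `J` is the commutator ideal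
of `u(L)`. -/
theorem nonempty_derivedP_quotient_equiv :
    Nonempty ((derivedP p F L).map (mainIdeal p F L).mkQ ≃ₗ[F]
      (commutatorIdeal F (uEnv p F L)).map (mixedProduct F (omegaIdeal p F L)).mkQ) := by
  set K := mixedProduct F (omegaIdeal p F L)
  have hle : mainIdeal p F L ≤ LinearMap.ker (K.mkQ ∘ₗ uemb p F L) := fun x hx => by
    simpa using uemb_mem_mixedProduct p F hx
  let j := (mainIdeal p F L).liftQ _ hle
  have hj : j ∘ₗ (mainIdeal p F L).mkQ = K.mkQ ∘ₗ uemb p F L := Submodule.liftQ_mkQ _ _ _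
  have hmap : ((derivedP p F L).map (mainIdeal p F L).mkQ).map j =
      (commutatorIdeal F (uEnv p F L)).map K.mkQ := by
    rw [← Submodule.map_comp, hj, Submodule.map_comp]
    refine le_antisymm (Submodule.map_mono ?_) ?_
    · rintro _ ⟨x, hx, rfl⟩
      exact uemb_mem_commutatorIdeal p F hx
    · refine (Submodule.map_mono (commutatorIdeal_le_derivedSub_sup p F)).trans ?_
      rw [Submodule.map_sup, Submodule.mkQ_map_self, sup_bot_eq]
      exact Submodule.map_mono (Submodule.map_mono (derivedSub_le_derivedP p F))
  have hinj : Function.Injective (j.domRestrict ((derivedP p F L).map (mainIdeal p F L).mkQ)) := by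
    rw [← LinearMap.ker_eq_bot, LinearMap.ker_eq_bot']
    rintro ⟨_, x, hx, rfl⟩ h
    replace h : K.mkQ (uemb p F L x) = 0 := h
    rw [Submodule.mkQ_apply, Submodule.Quotient.mk_eq_zero] at h
    rw [Subtype.ext_iff]
    exact (Submodule.Quotient.mk_eq_zero _).2 (mem_mainIdeal_of_uemb_mem_mixedProduct hx h)
  exact ⟨(LinearEquiv.ofInjective _ hinj).trans
    (LinearEquiv.ofEq _ _ ((LinearMap.range_domRestrict _ _).trans hmap))⟩

variable {p F}

/-- Every augmentation of `u(L)` agrees with the standard one if `L` is `p`-nilpotent. -/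
theorem IsPNilpotent.algHom_eq_aug (hL : IsPNilpotent p F L) (f : uEnv p F L →ₐ[F] F) :
    f = aug p F L := by
  obtain ⟨s, hs⟩ := hL
  refine algHom_ext fun x => ?_
  have hpow (n : ℕ) : uemb p F L x ^ p ^ n = uemb p F L ((pmap p F L)^[n] x) := by
    induction n with
    | zero => simp
    | succ n ih => rw [pow_succ, pow_mul, ih, Function.iterate_succ_apply', uemb_pmap]
  have hzero : (pmap p F L)^[s] x = 0 := by
    have h := pmap_iterate_mem p F x s
    rwa [hs, LieSubalgebra.mem_bot] at h
  rw [aug_uemb]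
  refine eq_zero_of_pow_eq_zero (n := p ^ s) ?_
  rw [← map_pow, hpow, hzero, map_zero, map_zero]

theorem IsPNilpotent.map_omegaIdeal (hL : IsPNilpotent p F L)
    (e : uEnv p F L ≃ₐ[F] uEnv p F H) :
    (omegaIdeal p F L).map e.toAlgHom.toLinearMap = omegaIdeal p F H := by
  have h (a : uEnv p F L) : aug p F H (e a) = aug p F L a :=
    DFunLike.congr_fun (hL.algHom_eq_aug ((aug p F H).comp e.toAlgHom)) a
  ext a
  constructor
  · rintro ⟨a, ha, rfl⟩
    exact (h a).trans ha
  · intro ha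
    refine ⟨e.symm a, ?_, e.apply_symm_apply a⟩
    change aug p F L (e.symm a) = 0
    rw [← h, e.apply_symm_apply]
    exact ha

end Dimension

end RestrictedLieAlgebra

open RestrictedLieAlgebra in
/-- If `L` is finite-dimensional and `p`-nilpotent and `u(L) ≅ u(H)`, then
`dim_F L/(L'^p + γ₃(L)) = dim_F H/(H'^p + γ₃(H))`. -/
theorem dim_main_quotient_determined
    (p : ℕ) (F L H : Type*) [Field F] [Fact p.Prime] [CharP F p]
    [LieRing L] [LieAlgebra F L] [RestrictedLieAlgebra p F L]
    [LieRing H] [LieAlgebra F H] [RestrictedLieAlgebra p F H]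
    [FiniteDimensional F L] (hL : IsPNilpotent p F L)
    (hiso : Nonempty (uEnv p F L ≃ₐ[F] uEnv p F H)) :
    Module.finrank F (L ⧸ mainIdeal p F L) = Module.finrank F (H ⧸ mainIdeal p F H) := by
  obtain ⟨e⟩ := hiso
  obtain ⟨hfin, hrank⟩ := finrank_quotient_derivedP_eq e
  obtain ⟨eL⟩ := nonempty_derivedP_quotient_equiv p F L
  obtain ⟨eH⟩ := nonempty_derivedP_quotient_equiv p F H
  obtain ⟨eJ⟩ := nonempty_commutatorIdeal_quotient_equiv e (hL.map_omegaIdeal e)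
  let E := eL.trans (eJ.trans eH.symm)
  have hfinP : Module.Finite F ((derivedP p F H).map (mainIdeal p F H).mkQ) := Module.Finite.equiv E
  have hfinQ : Module.Finite F ((H ⧸ mainIdeal p F H) ⧸
      (derivedP p F H).map (mainIdeal p F H).mkQ) :=
    Module.Finite.equiv
      (Submodule.quotientQuotientEquivQuotient _ _ (mainIdeal_le_derivedP p F)).symm
  have hfinM : Module.Finite F (H ⧸ mainIdeal p F H) :=
    Module.Finite.of_submodule_quotient ((derivedP p F H).map (mainIdeal p F H).mkQ)
  rw [finrank_quotient_mainIdeal, finrank_quotient_mainIdeal, hrank, E.finrank_eq]
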